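/- Let K be an algebraically closed field of characteristic 0, let η ∈ K with η ≠ 0 and η ≠ 1, let γ ∈ K with γ ≠ 0, and let A = A(1+η, −η, γ). Then every finite-dimensional left A-module is semisimple if and only if for all positive integers m ≠ n it is not the case that η^m ≠ 1, η^n ≠ 1 and n·(η^m − 1) = m·(η^n − 1) (i.e. η ∉ X_{m,n} for all m ≠ n). -/

import Mathlib

noncomputable section

/-- The defining relations of the down-up algebra `A(α,β,γ)`:
generator `0` is `d`, generator `1` is `u`. -/
inductive DownUpRel (K : Type) [Field K] (α β γ : K) :
    FreeAlgebra K (Fin 2) → FreeAlgebra K (Fin 2) → Prop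
  | rel1 : DownUpRel K α β γ
      (FreeAlgebra.ι K 0 * FreeAlgebra.ι K 0 * FreeAlgebra.ι K 1)
      (α • (FreeAlgebra.ι K 0 * FreeAlgebra.ι K 1 * FreeAlgebra.ι K 0) +
        β • (FreeAlgebra.ι K 1 * FreeAlgebra.ι K 0 * FreeAlgebra.ι K 0) +
        γ • FreeAlgebra.ι K 0)
  | rel2 : DownUpRel K α β γ
      (FreeAlgebra.ι K 0 * FreeAlgebra.ι K 1 * FreeAlgebra.ι K 1)
      (α • (FreeAlgebra.ι K 1 * FreeAlgebra.ι K 0 * FreeAlgebra.ι K 1) +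
        β • (FreeAlgebra.ι K 1 * FreeAlgebra.ι K 1 * FreeAlgebra.ι K 0) +
        γ • FreeAlgebra.ι K 1)

/-- The down-up algebra `A(α,β,γ)`. -/
abbrev DownUp (K : Type) [Field K] (α β γ : K) := RingQuot (DownUpRel K α β γ)

/-- The generator `d` of the down-up algebra. -/
def DownUp.d (K : Type) [Field K] (α β γ : K) : DownUp K α β γ :=
  RingQuot.mkAlgHom K (DownUpRel K α β γ) (FreeAlgebra.ι K 0)

/-- The generator `u` of the down-up algebra. -/
def DownUp.u (K : Type) [Field K] (α β γ : K) : DownUp K α β γ :=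
  RingQuot.mkAlgHom K (DownUpRel K α β γ) (FreeAlgebra.ι K 1)

namespace DownUp

open Polynomial Finset

section Triple

variable {K V : Type} [Field K] [AddCommGroup V] [Module K V]

/-- Operators `D`, `U` on a vector space whose commutator is `W + c`, where `W` commutes with
`D` and `U` up to the scalar `η`. -/
structure IsTriple (η c : K) (D U W : Module.End K V) : Prop where
  du : ∀ x, D (U x) = U (D x) + W x + c • x
  dw : ∀ x, D (W x) = η • W (D x)
  wu : ∀ x, W (U x) = η • U (W x)

/-- The coefficient of `U ^ (n - 1) v` in `D (U ^ n v)`, for `v` killed by `D` with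
`W v = a • v`. -/
def weight (η c a : K) (n : ℕ) : K := a * ∑ i ∈ range n, η ^ i + n * c

variable {η c : K} {D U W : Module.End K V}

lemma weight_zero (a : K) : weight η c a 0 = 0 := by simp [weight]

lemma weight_add (a : K) (k m : ℕ) :
    weight η c a (k + m) = weight η c a k + weight η c (η ^ k * a) m := by
  simp only [weight, sum_range_add, pow_add, ← mul_sum]
  push_cast
  ring

lemma weight_inv (hη : η ≠ 0) (b : K) (k : ℕ) :
    weight η⁻¹ c (η⁻¹ * (η ^ k * b)) k = weight η c b k := by
  have h : η⁻¹ * η ^ k * ∑ i ∈ range k, η⁻¹ ^ i = ∑ i ∈ range k, η ^ i := by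
    rw [← sum_range_reflect, mul_sum]
    refine sum_congr rfl fun i hi => ?_
    obtain ⟨j, rfl⟩ := Nat.exists_eq_add_of_lt (mem_range.1 hi)
    rw [show i + j + 1 - 1 - i = j by omega, inv_pow]
    field_simp
    ring
  simp only [weight, ← h]
  ring

namespace IsTriple

lemma swap (h : IsTriple η c D U W) (hη : η ≠ 0) : IsTriple η⁻¹ c U (-D) W where
  du x := by simp [h.du]; abel
  dw x := by rw [h.wu, smul_smul, inv_mul_cancel₀ hη, one_smul]
  wu x := by simp [h.dw, smul_smul, inv_mul_cancel₀ hη]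

lemma d_u_pow (h : IsTriple η c D U W) (k : ℕ) (x : V) :
    D ((U ^ (k + 1)) x) = (U ^ (k + 1)) (D x) +
      (U ^ k) ((∑ i ∈ range (k + 1), η ^ i) • W x + ((k + 1 : ℕ) * c) • x) := by
  induction k generalizing x with
  | zero => simp [h.du, add_assoc]
  | succ k ih =>
    rw [pow_succ, Module.End.mul_apply, ih, h.du, h.wu, geom_sum_succ (n := k + 1)]
    simp only [pow_succ, Module.End.mul_apply, map_add, map_smul]
    push_cast
    module

lemma d_u_pow_of_weight (h : IsTriple η c D U W) {x : V} {a : K} (hx : U (D x) = 0)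
    (ha : W x = a • x) (k : ℕ) :
    D ((U ^ (k + 1)) x) = weight η c a (k + 1) • (U ^ k) x := by
  rw [h.d_u_pow, pow_succ, Module.End.mul_apply, hx, ha]
  simp only [map_add, map_smul, map_zero, weight]
  module

lemma d_pow_u_d (h : IsTriple η c D U W) (k : ℕ) (x : V) :
    (D ^ k) (U (D x)) = U ((D ^ (k + 1)) x) + ((k : K) * c) • (D ^ k) x +
      (∑ i ∈ range k, η ^ i) • W ((D ^ k) x) := by
  induction k with
  | zero => simp
  | succ k ih =>
    rw [pow_succ' D k, Module.End.mul_apply, ih, geom_sum_succ (n := k)]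
    simp only [pow_succ', Module.End.mul_apply, map_add, map_smul, h.du, h.dw]
    push_cast
    module

lemma aeval_d_w (h : IsTriple η c D U W) (q : K[X]) (x : V) :
    aeval D q (W x) = W (aeval (η • D) q x) := by
  induction q using Polynomial.induction_on' generalizing x with
  | add p q hp hq => simp [hp, hq]
  | monomial k r =>
    have : (D ^ k) (W x) = η ^ k • W ((D ^ k) x) := by
      induction k with
      | zero => simp
      | succ k ih =>
        rw [pow_succ' D, Module.End.mul_apply, ih, Module.End.mul_apply, map_smul, h.dw, smul_smul,
          pow_succ]
    simp [aeval_monomial, _root_.smul_pow, this, smul_comm (η ^ k) r]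

lemma aeval_d_u_d (h : IsTriple η c D U W) (q : K[X]) (x : V) :
    (η - 1) • (aeval D q (U (D x)) - U (aeval D q (D x)) - c • D (aeval D (derivative q) x)) =
      W (aeval (η • D) q x - aeval D q x) := by
  induction q using Polynomial.induction_on' with
  | add p q hp hq =>
    simp only [map_add, LinearMap.add_apply] at hp hq ⊢
    rw [add_sub_add_comm (aeval (η • D) p x), map_add, ← hp, ← hq]
    module
  | monomial k r =>
    have h1 : D (aeval D (derivative (monomial k r)) x) = (r * k) • (D ^ k) x := by
      cases k with
      | zero => simp
      | succ k => simp [aeval_monomial, pow_succ', mul_smul, add_smul, Nat.cast_smul_eq_nsmul]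
    have h2 : η ^ k = (η - 1) * ∑ i ∈ range k, η ^ i + 1 := by rw [mul_geom_sum]; ring
    rw [h1]
    simp only [aeval_monomial, _root_.smul_pow, Module.End.mul_apply,
      Module.algebraMap_end_apply, LinearMap.smul_apply, h.d_pow_u_d, h2, map_sub, map_smul,
      pow_succ]
    module

/-- On a finite-dimensional space `W` is injective: `D` and `U` would satisfy the Weyl relation
on its kernel. -/
lemma w_injective [FiniteDimensional K V] [CharZero K] (h : IsTriple η c D U W) (hc : c ≠ 0)
    (hη : η ≠ 0) : Function.Injective W := by
  rw [← LinearMap.ker_eq_bot]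
  have hD : ∀ x ∈ LinearMap.ker W, D x ∈ LinearMap.ker W := fun x hx => by
    have := h.dw x
    rw [LinearMap.mem_ker.1 hx, map_zero] at this
    exact (smul_eq_zero.1 this.symm).resolve_left hη
  have hU : ∀ x ∈ LinearMap.ker W, U x ∈ LinearMap.ker W := fun x hx => by
    rw [LinearMap.mem_ker, h.wu, LinearMap.mem_ker.1 hx, map_zero, smul_zero]
  have hcomm : D.restrict hD * U.restrict hU - U.restrict hU * D.restrict hD = c • 1 := by
    ext x
    simp [h.du]
  have htr := congrArg (LinearMap.trace K (LinearMap.ker W)) hcomm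
  rw [map_sub, LinearMap.trace_mul_comm, sub_self, map_smul, LinearMap.trace_one, smul_eq_mul,
    eq_comm, mul_eq_zero, or_iff_right hc, Nat.cast_eq_zero] at htr
  exact Submodule.finrank_eq_zero.1 htr

lemma isNilpotent_d [FiniteDimensional K V] [CharZero K] (h : IsTriple η c D U W) (hc : c ≠ 0)
    (hη : η ≠ 0) (hη1 : η ≠ 1) : IsNilpotent D := by
  have hW := h.w_injective hc hη
  set q := minpoly K D
  have hmonic : q.Monic := minpoly.monic (Algebra.IsIntegral.isIntegral D)
  have h0 : aeval D q = 0 := minpoly.aeval K D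
  have h1 : aeval (η • D) q = 0 := by
    ext x
    apply hW
    rw [← h.aeval_d_w, h0]
    simp
  have h2 : aeval D (X * derivative q) = 0 := by
    ext x
    have := h.aeval_d_u_d q x
    rw [h0, h1] at this
    simpa [sub_eq_zero, hη1, hc] using this
  have h3 : q ∣ X * derivative q - C (q.natDegree : K) * q :=
    (minpoly.dvd K D h2).sub (Dvd.intro_left _ rfl)
  have hcoeff : ∀ k : ℕ, (X * derivative q - C (q.natDegree : K) * q).coeff k =
      (k - q.natDegree : K) * q.coeff k := by
    rintro (_ | k)
    · simp
    · simp [coeff_X_mul, coeff_derivative]; ring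
  have h4 : X * derivative q - C (q.natDegree : K) * q = 0 := by
    refine eq_zero_of_dvd_of_degree_lt h3 ?_
    rw [degree_eq_natDegree hmonic.ne_zero, degree_lt_iff_coeff_zero]
    intro k hk
    rw [hcoeff]
    rcases hk.eq_or_lt with rfl | hk
    · simp
    · simp [coeff_eq_zero_of_natDegree_lt hk]
  have h5 : q = X ^ q.natDegree := by
    ext k
    have := hcoeff k
    rw [h4, coeff_zero, eq_comm, mul_eq_zero, sub_eq_zero, Nat.cast_inj] at this
    rw [coeff_X_pow]
    split_ifs with hk
    · rw [hk]; exact hmonic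
    · exact this.resolve_left hk
  refine ⟨q.natDegree, ?_⟩
  rw [h5] at h0
  simpa using h0

lemma isNilpotent_u [FiniteDimensional K V] [CharZero K] (h : IsTriple η c D U W) (hc : c ≠ 0)
    (hη : η ≠ 0) (hη1 : η ≠ 1) : IsNilpotent U :=
  (h.swap hη).isNilpotent_d hc (inv_ne_zero hη) (inv_ne_one.2 hη1)

lemma exists_weight_eq_zero (h : IsTriple η c D U W) (hU : IsNilpotent U) {x : V} {a : K}
    (hx0 : x ≠ 0) (hx : U (D x) = 0) (ha : W x = a • x) :
    ∃ n, weight η c a (n + 1) = 0 ∧ (U ^ (n + 1)) x = 0 := by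
  classical
  have hex : ∃ n, (U ^ n) x = 0 := hU.imp fun n hn => by rw [hn]; rfl
  obtain ⟨n, hn⟩ : ∃ n, Nat.find hex = n + 1 :=
    Nat.exists_eq_succ_of_ne_zero fun h0 => hx0 (by simpa [h0] using Nat.find_spec hex)
  have h1 : (U ^ (n + 1)) x = 0 := hn ▸ Nat.find_spec hex
  have h2 : (U ^ n) x ≠ 0 := Nat.find_min hex (by omega)
  refine ⟨n, ?_, h1⟩
  have h3 := h.d_u_pow_of_weight hx ha n
  rw [h1, map_zero] at h3
  exact (smul_eq_zero.1 h3.symm).resolve_right h2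

end IsTriple

/-- For every `a`, the sequence `weight η c a` has at most one zero at a positive index. -/
def UniqueZeros (η c : K) : Prop :=
  ∀ a m n, 0 < m → 0 < n → weight η c a m = 0 → weight η c a n = 0 → m = n

namespace UniqueZeros

variable [CharZero K]

lemma isCoprime (hw : UniqueZeros η c) (hc : c ≠ 0) {m n : ℕ} (hmn : m ≠ n) (hm : 0 < m)
    (hn : 0 < n) :
    IsCoprime (C (∑ i ∈ range m, η ^ i) * X + C (m * c))
      (C (∑ i ∈ range n, η ^ i) * X + C (n * c)) := by
  have hdet : (∑ i ∈ range m, η ^ i) ≠ 0 →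
      (∑ i ∈ range m, η ^ i) * (n * c) - (∑ i ∈ range n, η ^ i) * (m * c) ≠ 0 := by
    intro h0 h1
    refine hmn (hw (-(m * c) / ∑ i ∈ range m, η ^ i) m n hm hn ?_ ?_)
    · rw [weight]; field_simp; ring
    · rw [weight]; field_simp; linear_combination h1
  by_cases h0 : (∑ i ∈ range m, η ^ i) = 0
  · rw [h0, C_0, zero_mul, zero_add]
    have : (m * c : K) ≠ 0 := mul_ne_zero (Nat.cast_ne_zero.2 hm.ne') hc
    exact ⟨C (m * c : K)⁻¹, 0, by rw [← C_mul, inv_mul_cancel₀ this]; simp⟩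
  · have h1 := hdet h0
    set e := (∑ i ∈ range m, η ^ i) * (n * c) - (∑ i ∈ range n, η ^ i) * (m * c) with he
    refine ⟨-C (e⁻¹ * ∑ i ∈ range n, η ^ i), C (e⁻¹ * ∑ i ∈ range m, η ^ i), ?_⟩
    have : C e⁻¹ * C e = 1 := by rw [← C_mul, inv_mul_cancel₀ h1, C_1]
    rw [← this]
    nth_rw 4 [he]
    simp only [C_mul, C_sub]
    ring

lemma squarefree_prod (hw : UniqueZeros η c) (hc : c ≠ 0) (N : ℕ) :
    Squarefree (∏ k ∈ range N, (C (∑ i ∈ range (k + 1), η ^ i) * X + C ((k + 1 : ℕ) * c))) := by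
  refine squarefree_prod_of_pairwise_isCoprime ?_ ?_
  · intro m _ n _ hmn
    exact (hw.isCoprime hc (by simpa using hmn) m.succ_pos n.succ_pos).isRelPrime
  · intro k _
    by_cases h0 : (∑ i ∈ range (k + 1), η ^ i) = 0
    · rw [h0, C_0, zero_mul, zero_add]
      exact (isUnit_C.2 (by simp [Nat.cast_add_one_ne_zero, hc])).squarefree
    · exact (irreducible_of_degree_eq_one (degree_linear h0)).squarefree

end UniqueZeros

namespace IsTriple

lemma u_d_w (h : IsTriple η c D U W) (x : V) : U (D (W x)) = W (U (D x)) := by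
  rw [h.dw, map_smul, h.wu]

lemma d_pow_u_pow (h : IsTriple η c D U W) (N : ℕ) {x : V} (hx : U (D x) = 0) :
    (D ^ N) ((U ^ N) x) = aeval W
      (∏ k ∈ range N, (C (∑ i ∈ range (k + 1), η ^ i) * X + C ((k + 1 : ℕ) * c))) x := by
  induction N generalizing x with
  | zero => simp
  | succ N ih =>
    rw [pow_succ D, Module.End.mul_apply, h.d_u_pow, pow_succ U, Module.End.mul_apply, hx, map_zero,
      zero_add, ih, prod_range_succ, map_mul, Module.End.mul_apply]
    · congr 1
      rw [map_add, map_mul, aeval_C, aeval_C, aeval_X]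
      simp only [LinearMap.add_apply, Module.End.mul_apply, Module.algebraMap_end_apply]
    · simp only [map_add, map_smul, h.u_d_w, hx, map_zero, smul_zero, add_zero]

lemma weight_ne_zero (h : IsTriple η c D U W) (hw : UniqueZeros η c) (hU : IsNilpotent U) {v : V}
    {a : K} (hv : D v = 0) (ha : W v = a • v) {k : ℕ} (hk : (U ^ (k + 1)) v ≠ 0) :
    weight η c a (k + 1) ≠ 0 := by
  intro h0
  have hv0 : v ≠ 0 := fun hv0 => hk (by rw [hv0, map_zero])
  obtain ⟨n, hn, hn'⟩ := h.exists_weight_eq_zero hU hv0 (by rw [hv, map_zero]) ha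
  rw [hw a (k + 1) (n + 1) k.succ_pos n.succ_pos h0 hn] at hk
  exact hk hn'

lemma d_pow_u_pow_eq_zero (h : IsTriple η c D U W) {v : V} {a : K} (hv : D v = 0)
    (ha : W v = a • v) {i k : ℕ} (hik : i < k) : (D ^ k) ((U ^ i) v) = 0 := by
  induction i generalizing k with
  | zero =>
    obtain ⟨k, rfl⟩ := Nat.exists_eq_succ_of_ne_zero hik.ne'
    simp [pow_succ, hv]
  | succ i ih =>
    obtain ⟨k, rfl⟩ := Nat.exists_eq_succ_of_ne_zero (Nat.ne_zero_of_lt hik)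
    rw [pow_succ, Module.End.mul_apply, h.d_u_pow_of_weight (by rw [hv, map_zero]) ha, map_smul,
      ih (by omega), smul_zero]

lemma exists_d_pow_u_pow (h : IsTriple η c D U W) (hw : UniqueZeros η c) (hU : IsNilpotent U)
    {v : V} {a : K} (hv : D v = 0) (ha : W v = a • v) {k : ℕ} (hk : (U ^ k) v ≠ 0) :
    ∃ r : K, r ≠ 0 ∧ (D ^ k) ((U ^ k) v) = r • v := by
  induction k with
  | zero => exact ⟨1, one_ne_zero, by simp⟩
  | succ k ih =>
    obtain ⟨r, hr, hr'⟩ := ih fun h0 => hk (by rw [pow_succ', Module.End.mul_apply, h0, map_zero])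
    refine ⟨weight η c a (k + 1) * r, mul_ne_zero (h.weight_ne_zero hw hU hv ha hk) hr, ?_⟩
    rw [pow_succ, Module.End.mul_apply, h.d_u_pow_of_weight (by rw [hv, map_zero]) ha, map_smul,
      hr', smul_smul]

/-- Powers of `D` carry every nonzero vector of a highest weight space back to the highest
weight vector. -/
lemma exists_d_pow_eq_smul (h : IsTriple η c D U W) (hw : UniqueZeros η c) (hU : IsNilpotent U)
    {v : V} {a : K} (hv : D v = 0) (ha : W v = a • v) {x : V} (hx0 : x ≠ 0)
    (hx : x ∈ Submodule.span K (Set.range fun i : ℕ => (U ^ i) v)) :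
    ∃ (j : ℕ) (r : K), r ≠ 0 ∧ (D ^ j) x = r • v := by
  have key : ∀ (k : ℕ) (x : V), x ≠ 0 →
      x ∈ Submodule.span K ((fun i : ℕ => (U ^ i) v) '' Set.Iio k) →
      ∃ (j : ℕ) (r : K), r ≠ 0 ∧ (D ^ j) x = r • v := by
    intro k
    induction k with
    | zero => intro x hx0 hx; simp [hx0] at hx
    | succ k ih =>
      intro x hx0 hx
      rw [← Order.succ_eq_add_one, Order.Iio_succ_eq_insert, Set.image_insert_eq,
        Submodule.mem_span_insert] at hx
      obtain ⟨s, z, hz, rfl⟩ := hx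
      by_cases hs : s • (U ^ k) v = 0
      · rw [hs, zero_add] at hx0 ⊢
        exact ih z hx0 hz
      · obtain ⟨hs0, hUk⟩ := smul_ne_zero_iff.1 hs
        obtain ⟨r, hr, hr'⟩ := h.exists_d_pow_u_pow hw hU hv ha hUk
        have hzk : (D ^ k) z = 0 := by
          refine (Submodule.span_le (p := LinearMap.ker (D ^ k))).2 ?_ hz
          rintro _ ⟨i, hi, rfl⟩
          exact h.d_pow_u_pow_eq_zero hv ha hi
        exact ⟨k, s * r, mul_ne_zero hs0 hr, by rw [map_add, map_smul, hr', hzk, add_zero, mul_smul]⟩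
  obtain ⟨N, hN⟩ := hU
  refine key N x hx0 (Submodule.span_le.2 ?_ hx)
  rintro _ ⟨i, rfl⟩
  by_cases hi : i < N
  · exact Submodule.subset_span ⟨i, hi, rfl⟩
  · simp only [SetLike.mem_coe, pow_eq_zero_of_le (not_lt.1 hi) hN, LinearMap.zero_apply]
    exact zero_mem _

variable [FiniteDimensional K V] [IsAlgClosed K] [CharZero K]

lemma mem_span_eigenvectors (h : IsTriple η c D U W) (hw : UniqueZeros η c) (hc : c ≠ 0)
    (hU : IsNilpotent U) {x : V} (hx : U (D x) = 0) :
    x ∈ Submodule.span K {v | U (D v) = 0 ∧ ∃ a : K, W v = a • v} := by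
  set p := LinearMap.ker (U * D)
  have hp : ∀ y ∈ p, W y ∈ p := fun y hy => by
    have hy : U (D y) = 0 := hy
    change U (D (W y)) = 0
    rw [h.u_d_w, hy, map_zero]
  obtain ⟨N, hN⟩ := hU
  set P := ∏ k ∈ range N, (C (∑ i ∈ range (k + 1), η ^ i) * X + C ((k + 1 : ℕ) * c))
  let W' : Module.End K p := W.restrict hp
  have hcoe : ∀ (q : K[X]) (y : p), (aeval W' q y : V) = aeval W q y := fun q y => by
    induction q using Polynomial.induction_on' with
    | add q r hq hr => simp [hq, hr]
    | monomial k r =>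
      have : ((W' ^ k) y : V) = (W ^ k) y := by
        induction k with
        | zero => rfl
        | succ k ih =>
          rw [pow_succ', pow_succ', Module.End.mul_apply, Module.End.mul_apply, ← ih]
          rfl
      simp [aeval_monomial, this]
  have h0 : aeval W' P = 0 := by
    ext y
    rw [hcoe, ← h.d_pow_u_pow N y.2, hN]
    simp
  have hss := Module.End.isSemisimple_of_squarefree_aeval_eq_zero (hw.squarefree_prod hc N) h0
  have hmem : (⟨x, hx⟩ : p) ∈ ⨆ a, W'.eigenspace a :=
    hss.iSup_eigenspace_eq_top ▸ Submodule.mem_top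
  have hle : ⨆ a, W'.eigenspace a ≤
      (Submodule.span K {v | U (D v) = 0 ∧ ∃ a : K, W v = a • v}).comap p.subtype := by
    refine iSup_le fun a y hy => Submodule.subset_span ⟨y.2, a, ?_⟩
    exact congrArg Subtype.val (Module.End.mem_eigenspace_iff.1 hy)
  exact hle hmem

/-- A common lowest weight vector `D x` would produce two positive zeros of a weight function. -/
lemma ker_u_d (h : IsTriple η c D U W) (hw : UniqueZeros η c) (hc : c ≠ 0) (hη : η ≠ 0)
    (hη1 : η ≠ 1) {x : V} (hx : U (D x) = 0) : D x = 0 := by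
  have hU := h.isNilpotent_u hc hη hη1
  have hD := h.isNilpotent_d hc hη hη1
  refine (Submodule.span_le (p := LinearMap.ker D)).2 ?_ (h.mem_span_eigenvectors hw hc hU hx)
  rintro v ⟨hv, a, ha⟩
  by_contra hDv
  have hDv : D v ≠ 0 := hDv
  obtain ⟨m, hm, -⟩ := h.exists_weight_eq_zero hU (fun h0 => hDv (by rw [h0, map_zero])) hv ha
  have hWDv : W (D v) = (η⁻¹ * a) • D v := by
    rw [mul_smul, ← map_smul D, ← ha, h.dw, inv_smul_smul₀ hη]
  obtain ⟨k, hk, -⟩ := (h.swap hη).exists_weight_eq_zero hD.neg hDv (by simp [hv]) hWDv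
  set b := (η ^ (k + 1))⁻¹ * a with hb
  have hab : a = η ^ (k + 1) * b := by rw [hb, mul_inv_cancel_left₀ (pow_ne_zero _ hη)]
  rw [hab, weight_inv hη] at hk
  have := hw b (k + 1) (k + 1 + (m + 1)) (by omega) (by omega) hk
    (by rw [weight_add, hk, ← hab, hm, add_zero])
  omega

lemma mem_span_ker_d (h : IsTriple η c D U W) (hw : UniqueZeros η c) (hc : c ≠ 0) (hη : η ≠ 0)
    (hη1 : η ≠ 1) {x : V} (hx : U (D x) = 0) :
    x ∈ Submodule.span K {v | D v = 0 ∧ ∃ a : K, W v = a • v} :=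
  Submodule.span_le.2
    (fun _ hv => Submodule.subset_span (And.intro (h.ker_u_d hw hc hη hη1 hv.1) hv.2))
    (h.mem_span_eigenvectors hw hc (h.isNilpotent_u hc hη hη1) hx)

/-- The space is spanned by the images of highest weight vectors under powers of `U`. -/
lemma span_u_pow_eq_top (h : IsTriple η c D U W) (hw : UniqueZeros η c) (hc : c ≠ 0) (hη : η ≠ 0)
    (hη1 : η ≠ 1) : Submodule.span K
      {x | ∃ v, D v = 0 ∧ (∃ a : K, W v = a • v) ∧ ∃ i : ℕ, x = (U ^ i) v} = ⊤ := by
  have hU := h.isNilpotent_u hc hη hη1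
  set S := Submodule.span K
    {x | ∃ v, D v = 0 ∧ (∃ a : K, W v = a • v) ∧ ∃ i : ℕ, x = (U ^ i) v}
  have hker : ∀ x, U (D x) = 0 → x ∈ S := fun x hx =>
    (Submodule.span_le (p := S)).2 (fun v hv => Submodule.subset_span ⟨v, hv.1, hv.2, 0, rfl⟩)
      (h.mem_span_ker_d hw hc hη hη1 hx)
  have hlift : ∀ y ∈ S, ∃ s ∈ S, U (y - D s) = 0 := by
    intro y hy
    induction hy using Submodule.span_induction with
    | zero => exact ⟨0, S.zero_mem, by simp⟩
    | add y z _ _ hy hz =>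
      obtain ⟨s, hs, hs'⟩ := hy
      obtain ⟨t, ht, ht'⟩ := hz
      exact ⟨s + t, S.add_mem hs ht, by rw [map_add, add_sub_add_comm, map_add, hs', ht', add_zero]⟩
    | smul r y _ hy =>
      obtain ⟨s, hs, hs'⟩ := hy
      exact ⟨r • s, S.smul_mem r hs, by rw [map_smul, ← smul_sub, map_smul, hs', smul_zero]⟩
    | mem y hy =>
      obtain ⟨v, hv, ⟨a, ha⟩, i, rfl⟩ := hy
      by_cases h0 : (U ^ (i + 1)) v = 0
      · refine ⟨0, S.zero_mem, ?_⟩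
        rwa [map_zero, sub_zero, ← Module.End.mul_apply, ← pow_succ']
      · refine ⟨(weight η c a (i + 1))⁻¹ • (U ^ (i + 1)) v,
          S.smul_mem _ (Submodule.subset_span ⟨v, hv, ⟨a, ha⟩, i + 1, rfl⟩), ?_⟩
        rw [map_smul, h.d_u_pow_of_weight (by rw [hv, map_zero]) ha,
          inv_smul_smul₀ (h.weight_ne_zero hw hU hv ha h0), sub_self, map_zero]
  have hpow : ∀ (k : ℕ) (x : V), (D ^ k) x = 0 → x ∈ S := by
    intro k
    induction k with
    | zero => intro x hx; rw [show x = 0 from hx]; exact S.zero_mem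
    | succ k ih =>
      intro x hx
      obtain ⟨s, hs, hs'⟩ := hlift (D x) (ih _ (by rwa [← Module.End.mul_apply, ← pow_succ]))
      rw [← map_sub] at hs'
      exact (S.sub_mem_iff_left hs).1 (hker _ hs')
  obtain ⟨N, hN⟩ := h.isNilpotent_d hc hη hη1
  exact Submodule.eq_top_iff'.2 fun x => hpow N x (by rw [hN]; rfl)

end IsTriple

end Triple

section Module

variable {K : Type} [Field K] {α β γ : K}

lemma induction_on {p : DownUp K α β γ → Prop} (x : DownUp K α β γ)
    (algebraMap : ∀ r, p (algebraMap K _ r)) (d : p (d K α β γ)) (u : p (u K α β γ))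
    (add : ∀ x y, p x → p y → p (x + y)) (mul : ∀ x y, p x → p y → p (x * y)) : p x := by
  obtain ⟨y, rfl⟩ := RingQuot.mkAlgHom_surjective K _ x
  induction y using FreeAlgebra.induction with
  | grade0 r => rw [AlgHom.commutes]; exact algebraMap r
  | grade1 i => fin_cases i; exacts [d, u]
  | add a b ha hb => rw [map_add]; exact add _ _ ha hb
  | mul a b ha hb => rw [map_mul]; exact mul _ _ ha hb

lemma d_mul_d_mul_u : d K α β γ * d K α β γ * u K α β γ =
    α • (d K α β γ * u K α β γ * d K α β γ) + β • (u K α β γ * d K α β γ * d K α β γ) +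
      γ • d K α β γ := by
  simpa [d, u] using RingQuot.mkAlgHom_rel K (DownUpRel.rel1 (α := α) (β := β) (γ := γ))

lemma d_mul_u_mul_u : d K α β γ * u K α β γ * u K α β γ =
    α • (u K α β γ * d K α β γ * u K α β γ) + β • (u K α β γ * u K α β γ * d K α β γ) +
      γ • u K α β γ := by
  simpa [d, u] using RingQuot.mkAlgHom_rel K (DownUpRel.rel2 (α := α) (β := β) (γ := γ))

/-- A pair of operators satisfying the down-up relations defines a representation. -/
lemma exists_algHom {B : Type} [Ring B] [Algebra K B] (D U : B)
    (h1 : D * D * U = α • (D * U * D) + β • (U * D * D) + γ • D)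
    (h2 : D * U * U = α • (U * D * U) + β • (U * U * D) + γ • U) :
    ∃ φ : DownUp K α β γ →ₐ[K] B, φ (d K α β γ) = D ∧ φ (u K α β γ) = U := by
  have hrel : ∀ ⦃x y⦄, DownUpRel K α β γ x y →
      FreeAlgebra.lift K ![D, U] x = FreeAlgebra.lift K ![D, U] y := by
    rintro _ _ (_ | _)
    · simpa using h1
    · simpa using h2
  exact ⟨RingQuot.liftAlgHom K ⟨_, hrel⟩, by simp [d], by simp [u]⟩

variable {M : Type} [AddCommGroup M] [Module K M] [Module (DownUp K α β γ) M]
  [IsScalarTower K (DownUp K α β γ) M]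

/-- A subspace stable under `d` and `u` is a submodule. -/
def submoduleOfStable (p : Submodule K M) (hd : ∀ x ∈ p, d K α β γ • x ∈ p)
    (hu : ∀ x ∈ p, u K α β γ • x ∈ p) : Submodule (DownUp K α β γ) M where
  __ := p
  smul_mem' a x hx := by
    induction a using induction_on generalizing x with
    | algebraMap r => rw [algebraMap_smul]; exact p.smul_mem r hx
    | d => exact hd x hx
    | u => exact hu x hx
    | add a b ha hb => rw [add_smul]; exact p.add_mem (ha x hx) (hb x hx)
    | mul a b ha hb => rw [mul_smul]; exact ha _ (hb x hx)

end Module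

section Semisimple

variable {K : Type} [Field K] {η γ : K} {M : Type} [AddCommGroup M] [Module K M]
  [Module (DownUp K (1 + η) (-η) γ) M] [IsScalarTower K (DownUp K (1 + η) (-η) γ) M]

variable (M) in
/-- The action of an element of the algebra by a linear endomorphism. -/
abbrev act (a : DownUp K (1 + η) (-η) γ) : Module.End K M := Algebra.lsmul K K M a

lemma isTriple (hη1 : η ≠ 1) : IsTriple η (γ / (1 - η)) (act M (d K (1 + η) (-η) γ))
    (act M (u K (1 + η) (-η) γ)) (act M (d K (1 + η) (-η) γ * u K (1 + η) (-η) γ -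
      u K (1 + η) (-η) γ * d K (1 + η) (-η) γ - algebraMap K _ (γ / (1 - η)))) where
  du x := by
    simp only [Algebra.lsmul_coe, sub_smul, mul_smul, algebraMap_smul]
    abel
  dw x := by
    have h (y : M) := congrArg (act M · y) (d_mul_d_mul_u (α := 1 + η) (β := -η) (γ := γ))
    simp only [map_add, map_mul, map_smul, LinearMap.add_apply, LinearMap.smul_apply,
      Module.End.mul_apply] at h
    have hc (y : M) : γ • y = (1 - η) • (γ / (1 - η)) • y := by
      rw [smul_smul, mul_div_cancel₀ _ (sub_ne_zero.2 hη1.symm)]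
    simp only [map_sub, map_mul, LinearMap.sub_apply, Module.End.mul_apply, AlgHom.commutes,
      Module.algebraMap_end_apply, map_smul, h, hc]
    module
  wu x := by
    have h (y : M) := congrArg (act M · y) (d_mul_u_mul_u (α := 1 + η) (β := -η) (γ := γ))
    simp only [map_add, map_mul, map_smul, LinearMap.add_apply, LinearMap.smul_apply,
      Module.End.mul_apply] at h
    have hc (y : M) : γ • y = (1 - η) • (γ / (1 - η)) • y := by
      rw [smul_smul, mul_div_cancel₀ _ (sub_ne_zero.2 hη1.symm)]
    simp only [map_sub, map_mul, LinearMap.sub_apply, Module.End.mul_apply, AlgHom.commutes,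
      Module.algebraMap_end_apply, map_smul, h, hc]
    module

lemma isSimpleModule_span {c a : K} {W : Module.End K M}
    (h : IsTriple η c (act M (d K (1 + η) (-η) γ)) (act M (u K (1 + η) (-η) γ)) W)
    (hw : UniqueZeros η c) (hU : IsNilpotent (act M (u K (1 + η) (-η) γ))) {v : M} (hv0 : v ≠ 0)
    (hv : act M (d K (1 + η) (-η) γ) v = 0) (ha : W v = a • v) :
    IsSimpleModule (DownUp K (1 + η) (-η) γ)
      (Submodule.span (DownUp K (1 + η) (-η) γ) {v}) := by
  set D := act M (d K (1 + η) (-η) γ) with hD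
  set U := act M (u K (1 + η) (-η) γ)
  set S := Submodule.span K (Set.range fun i : ℕ => (U ^ i) v)
  have hSD : ∀ x ∈ S, d K (1 + η) (-η) γ • x ∈ S := by
    intro x hx
    refine (Submodule.span_le (p := S.comap D)).2 ?_ hx
    rintro _ ⟨_ | i, rfl⟩
    · simp [hv]
    · simp only [SetLike.mem_coe, Submodule.mem_comap]
      rw [h.d_u_pow_of_weight (by rw [hv, map_zero]) ha]
      exact S.smul_mem _ (Submodule.subset_span ⟨i, rfl⟩)
  have hSU : ∀ x ∈ S, u K (1 + η) (-η) γ • x ∈ S := by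
    intro x hx
    refine (Submodule.span_le (p := S.comap U)).2 ?_ hx
    rintro _ ⟨i, rfl⟩
    exact Submodule.subset_span ⟨i + 1, by simp [pow_succ']⟩
  have hle : Submodule.span (DownUp K (1 + η) (-η) γ) {v} ≤ submoduleOfStable S hSD hSU := by
    rw [Submodule.span_singleton_le_iff_mem]
    exact Submodule.subset_span ⟨0, rfl⟩
  rw [isSimpleModule_iff_isAtom]
  refine ⟨by simpa using hv0, fun N hN => ?_⟩
  by_contra hN0
  obtain ⟨x, hxN, hx0⟩ := N.ne_bot_iff.1 hN0
  obtain ⟨j, r, hr, hj⟩ := h.exists_d_pow_eq_smul hw hU hv ha hx0 (hle (hN.le hxN))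
  refine hN.not_ge ((Submodule.span_singleton_le_iff_mem _ _).2 ?_)
  have : v = (algebraMap K (DownUp K (1 + η) (-η) γ) r⁻¹ * d K (1 + η) (-η) γ ^ j) • x := by
    rw [mul_smul, algebraMap_smul, eq_inv_smul_iff₀ hr, ← hj, hD, ← map_pow]
    rfl
  rw [this]
  exact N.smul_mem _ hxN

lemma isSemisimpleModule [FiniteDimensional K M] [IsAlgClosed K] [CharZero K]
    (hη : η ≠ 0) (hη1 : η ≠ 1) (hγ : γ ≠ 0) (hw : UniqueZeros η (γ / (1 - η))) :
    IsSemisimpleModule (DownUp K (1 + η) (-η) γ) M := by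
  have hc : γ / (1 - η) ≠ 0 := div_ne_zero hγ (sub_ne_zero.2 hη1.symm)
  have h := isTriple (M := M) (γ := γ) hη1
  have hU := h.isNilpotent_u hc hη hη1
  apply IsSemisimpleModule.of_sSup_simples_eq_top
  rw [Submodule.eq_top_iff']
  intro x
  set T := sSup {m : Submodule (DownUp K (1 + η) (-η) γ) M |
    IsSimpleModule (DownUp K (1 + η) (-η) γ) m} 
  refine (Submodule.span_le (p := T.restrictScalars K)).2 ?_
    ((h.span_u_pow_eq_top hw hc hη hη1).symm ▸ Submodule.mem_top : x ∈ _)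
  rintro _ ⟨v, hv, ⟨a, ha⟩, i, rfl⟩
  by_cases hv0 : v = 0
  · simp [hv0]
  · have hsimple := isSimpleModule_span h hw hU hv0 hv ha
    have hvT : v ∈ T := le_sSup (α := Submodule _ M) hsimple (Submodule.mem_span_singleton_self v)
    rw [← map_pow]
    exact T.smul_mem _ hvT

end Semisimple

lemma uniqueZeros_iff {K : Type} [Field K] [CharZero K] {η c : K} (hη1 : η ≠ 1) (hc : c ≠ 0) :
    UniqueZeros η c ↔ ∀ m n : ℕ, 0 < m → 0 < n → m ≠ n →
      ¬ (η ^ m ≠ 1 ∧ η ^ n ≠ 1 ∧ (n : K) * (η ^ m - 1) = (m : K) * (η ^ n - 1)) := by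
  have hη1 : η - 1 ≠ 0 := sub_ne_zero.2 hη1
  simp only [← sub_ne_zero (a := η ^ _), ← mul_geom_sum η]
  refine ⟨fun hw m n hm hn hmn h => hmn ?_, fun H a m n hm hn h1 h2 => ?_⟩
  · obtain ⟨h1, -, h2⟩ := h
    have h0 := right_ne_zero_of_mul h1
    have h3 : (n : K) * ∑ i ∈ range m, η ^ i = m * ∑ i ∈ range n, η ^ i :=
      mul_left_cancel₀ hη1 (by linear_combination h2)
    refine hw (-(m * c) / ∑ i ∈ range m, η ^ i) m n hm hn ?_ ?_
    · rw [weight]; field_simp; ring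
    · rw [weight]; field_simp; linear_combination c * h3
  · by_contra hmn
    rw [weight] at h1 h2
    have hne : ∀ k : ℕ, 0 < k → a * ∑ i ∈ range k, η ^ i + k * c = 0 →
        a * ∑ i ∈ range k, η ^ i ≠ 0 := fun k hk h h0 => by
      rw [h0, zero_add] at h
      exact mul_ne_zero (Nat.cast_ne_zero.2 hk.ne') hc h
    have hm' := hne m hm h1
    refine H m n hm hn hmn ⟨mul_ne_zero hη1 (right_ne_zero_of_mul hm'),
      mul_ne_zero hη1 (right_ne_zero_of_mul (hne n hn h2)), ?_⟩
    refine mul_left_cancel₀ (left_ne_zero_of_mul hm') ?_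
    linear_combination (η - 1) * (n * h1 - m * h2)

section Sequence

variable {K : Type} [Field K]

/-- The shift operator on sequences. -/
def seqD : Module.End K (ℕ → K) where
  toFun g i := g (i + 1)
  map_add' _ _ := rfl
  map_smul' _ _ := rfl

/-- The weighted raising operator on sequences. -/
def seqU (f : ℕ → K) : Module.End K (ℕ → K) where
  toFun g i := f i * g (i - 1)
  map_add' _ _ := by ext; simp [mul_add]
  map_smul' _ _ := by ext; simp [mul_left_comm]

/-- The sequences supported on indices less than `n`. -/
def seqLT (n : ℕ) : Submodule K (ℕ → K) where
  carrier := {g | ∀ i, n ≤ i → g i = 0}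
  add_mem' ha hb i hi := by simp [ha i hi, hb i hi]
  zero_mem' _ _ := rfl
  smul_mem' r g hg i hi := by simp [hg i hi]

lemma seqD_apply (g : ℕ → K) (i : ℕ) : seqD g i = g (i + 1) := rfl

lemma seqU_apply (f g : ℕ → K) (i : ℕ) : seqU f g i = f i * g (i - 1) := rfl

lemma seqD_pow_apply (k : ℕ) (g : ℕ → K) (i : ℕ) : (seqD ^ k) g i = g (i + k) := by
  induction k generalizing i with
  | zero => rfl
  | succ k ih => rw [pow_succ', Module.End.mul_apply, seqD_apply, ih, add_right_comm, add_assoc]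

lemma seqD_mem {n : ℕ} {g : ℕ → K} (hg : g ∈ seqLT n) : seqD g ∈ seqLT n :=
  fun i hi => hg (i + 1) (by omega)

lemma seqU_mem {f : ℕ → K} {n : ℕ} (hn : f n = 0) {g : ℕ → K} (hg : g ∈ seqLT n) :
    seqU f g ∈ seqLT n := fun i hi => by
  rcases hi.eq_or_lt with rfl | hi
  · rw [seqU_apply, hn, zero_mul]
  · rw [seqU_apply, hg (i - 1) (by omega), mul_zero]

/-- If the coefficients of `u` vanish at two positive indices `m < n`, then the sequences
supported below `m` form a submodule without complement in those supported below `n`. -/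
lemma exists_not_isSemisimpleModule {α β γ : K} {f : ℕ → K} (h0 : f 0 = 0)
    (hf : ∀ i, f (i + 2) = α * f (i + 1) + β * f i + γ) {m n : ℕ} (hm : 0 < m) (hmn : m < n)
    (hfm : f m = 0) (hfn : f n = 0) :
    ∃ (M : Type) (_ : AddCommGroup M) (_ : Module K M) (_ : Module (DownUp K α β γ) M)
      (_ : IsScalarTower K (DownUp K α β γ) M),
      FiniteDimensional K M ∧ ¬ IsSemisimpleModule (DownUp K α β γ) M := by
  have h1 : seqD * seqD * seqU f =
      α • (seqD * seqU f * seqD) + β • (seqU f * seqD * seqD) + γ • seqD := by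
    refine LinearMap.ext fun g => funext fun i => ?_
    simp only [Module.End.mul_apply, LinearMap.add_apply, LinearMap.smul_apply, Pi.add_apply,
      Pi.smul_apply, smul_eq_mul, seqD_apply, seqU_apply, hf, Nat.add_sub_cancel]
    rcases i with _ | i
    · simp [h0]; ring
    · simp; ring
  have h2 : seqD * seqU f * seqU f =
      α • (seqU f * seqD * seqU f) + β • (seqU f * seqU f * seqD) + γ • seqU f := by
    refine LinearMap.ext fun g => funext fun i => ?_
    simp only [Module.End.mul_apply, LinearMap.add_apply, LinearMap.smul_apply, Pi.add_apply,
      Pi.smul_apply, smul_eq_mul, seqD_apply, seqU_apply, Nat.add_sub_cancel]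
    rcases i with _ | _ | i
    · simp [h0]
    · simp [h0, hf 0]; ring
    · simp [hf (i + 1)]; ring
  obtain ⟨φ, hφd, hφu⟩ := exists_algHom seqD (seqU f) h1 h2
  let _ : Module (DownUp K α β γ) (ℕ → K) := Module.compHom _ φ.toRingHom
  have hsmul (a : DownUp K α β γ) (g : ℕ → K) : a • g = φ a g := rfl
  have : IsScalarTower K (DownUp K α β γ) (ℕ → K) :=
    ⟨fun r a g => by rw [hsmul, hsmul, map_smul, LinearMap.smul_apply]⟩
  have hd (k : ℕ) : ∀ g ∈ seqLT k, d K α β γ • g ∈ seqLT k := fun g hg => by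
    rw [hsmul, hφd]; exact seqD_mem hg
  have hu {k : ℕ} (hk : f k = 0) : ∀ g ∈ seqLT k, u K α β γ • g ∈ seqLT k := fun g hg => by
    rw [hsmul, hφu]; exact seqU_mem hk hg
  let P := submoduleOfStable (α := α) (β := β) (γ := γ) (seqLT n) (hd n) (hu hfn)
  let N := (submoduleOfStable (α := α) (β := β) (γ := γ) (seqLT m) (hd m) (hu hfm)).comap P.subtype
  refine ⟨P, inferInstance, inferInstance, inferInstance, inferInstance, ?_, fun hss => ?_⟩
  · let e : P →ₗ[K] (Fin n → K) :=
      { toFun g i := g.1 i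
        map_add' _ _ := rfl
        map_smul' _ _ := rfl }
    refine Module.Finite.of_injective e fun g g' h => Subtype.ext (funext fun i => ?_)
    by_cases hi : i < n
    · exact congrFun h ⟨i, hi⟩
    · rw [g.2 i (not_lt.1 hi), g'.2 i (not_lt.1 hi)]
  · obtain ⟨C, hC⟩ := hss.toComplementedLattice.exists_isCompl N
    have hbot : C = ⊥ := by
      by_contra hC0
      obtain ⟨g, hgC, hg0⟩ := C.ne_bot_iff.1 hC0
      classical
      have hex : ∃ k, ∀ i, k ≤ i → g.1 i = 0 := ⟨n, g.2⟩
      obtain ⟨k, hk⟩ : ∃ k, Nat.find hex = k + 1 :=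
        Nat.exists_eq_succ_of_ne_zero fun h => hg0 (Subtype.ext (funext fun i =>
          Nat.find_spec hex i (by omega)))
      have hlast : ∀ i, k + 1 ≤ i → g.1 i = 0 := hk ▸ Nat.find_spec hex
      have hgk : g.1 k ≠ 0 := fun hgk => Nat.find_min hex (m := k) (by omega) fun i hi => by
        rcases hi.eq_or_lt with rfl | hi
        exacts [hgk, hlast i hi]
      have hval (i : ℕ) : (d K α β γ ^ k • g).1 i = g.1 (i + k) := by
        rw [← seqD_pow_apply k g.1 i, ← hφd, ← map_pow]
        rfl
      have hN : d K α β γ ^ k • g ∈ N := fun i hi => (hval i).trans (hlast _ (by omega))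
      have := (Submodule.disjoint_def.1 hC.disjoint) _ hN (C.smul_mem _ hgC)
      apply hgk
      rw [← zero_add k, ← hval 0, this]
      rfl
    have htop : N = ⊤ := by simpa [hbot] using hC.sup_eq_top
    have hmem : Pi.single m (1 : K) ∈ seqLT n := fun i hi => Pi.single_eq_of_ne (by omega) _
    have : (⟨Pi.single m 1, hmem⟩ : P) ∈ N := htop ▸ Submodule.mem_top
    simpa using this m le_rfl

end Sequence

end DownUp

/-- for `A_η = A(1+η, −η, γ)` with `η ≠ 0,1`, `γ ≠ 0`,
`char K = 0`, all finite-dimensional left `A_η`-modules are semisimple if and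
only if `η ∉ X_{m,n}` for all positive integers `m ≠ n`, where
`X_{m,n} = {η | η^m ≠ 1, η^n ≠ 1, n·(η^m − 1) = m·(η^n − 1)}`. -/
theorem downUp_eta_semisimple_iff (K : Type) [Field K] [IsAlgClosed K]
    [CharZero K] (η γ : K) (hη0 : η ≠ 0) (hη1 : η ≠ 1) (hγ : γ ≠ 0) :
    (∀ (M : Type) (_ : AddCommGroup M) (_ : Module K M)
        (_ : Module (DownUp K (1 + η) (-η) γ) M)
        (_ : IsScalarTower K (DownUp K (1 + η) (-η) γ) M),
        FiniteDimensional K M → IsSemisimpleModule (DownUp K (1 + η) (-η) γ) M) ↔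
    (∀ m n : ℕ, 0 < m → 0 < n → m ≠ n →
      ¬ (η ^ m ≠ 1 ∧ η ^ n ≠ 1 ∧ (n : K) * (η ^ m - 1) = (m : K) * (η ^ n - 1))) := by
  have hη : 1 - η ≠ 0 := sub_ne_zero.2 hη1.symm
  rw [← DownUp.uniqueZeros_iff hη1 (div_ne_zero hγ hη)]
  refine ⟨fun H a m n hm hn h1 h2 => ?_, fun hw M _ _ _ _ _ =>
    DownUp.isSemisimpleModule hη0 hη1 hγ hw⟩
  have hrec : ∀ i, DownUp.weight η (γ / (1 - η)) a (i + 2) =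
      (1 + η) * DownUp.weight η (γ / (1 - η)) a (i + 1) +
        -η * DownUp.weight η (γ / (1 - η)) a i + γ := fun i => by
    simp only [DownUp.weight, Finset.sum_range_succ]
    push_cast
    field_simp
    ring
  have key : ∀ {m n : ℕ}, 0 < m → m < n → DownUp.weight η (γ / (1 - η)) a m = 0 →
      DownUp.weight η (γ / (1 - η)) a n ≠ 0 := fun hm hmn h1 h2 => by
    obtain ⟨M, _, _, _, htower, hfin, hss⟩ :=
      DownUp.exists_not_isSemisimpleModule (DownUp.weight_zero a) hrec hm hmn h1 h2
    exact hss (H M _ _ _ htower hfin)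
  rcases lt_trichotomy m n with hmn | hmn | hmn
  exacts [absurd h2 (key hm hmn h1), hmn, absurd h1 (key hn hmn h2)]
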